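/- Let H be a graph and c an integer with 3 ≤ c ≤ |V(H)|. Then either H contains a cycle of length at least c, or the number of edges of H satisfies e(H) < (c−1)(|V(H)|−1)/2 + 1. -/

import Mathlib

open SimpleGraph Finset

/-- `F` is contained in `G` as a (not necessarily induced) subgraph. -/
def ContainsCopy {α β : Type*} (F : SimpleGraph α) (G : SimpleGraph β) : Prop :=
  ∃ f : α → β, Function.Injective f ∧ ∀ a b, F.Adj a b → G.Adj (f a) (f b)

/-- Every red/blue coloring of `K_N` yields a red `F` or a blue `G`. -/
def IsRamsey {α β : Type*} (F : SimpleGraph α) (G : SimpleGraph β) (N : ℕ) : Prop :=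
  ∀ R : SimpleGraph (Fin N), ContainsCopy F R ∨ ContainsCopy G Rᶜ

/-- The two color Ramsey number `R(F,G)`. -/
noncomputable def ramseyNumber {α β : Type*} (F : SimpleGraph α) (G : SimpleGraph β) : ℕ :=
  sInf {N | IsRamsey F G N}

/-- The chromatic number of `G` as a natural number. -/
noncomputable def chromNum {V : Type*} (G : SimpleGraph V) : ℕ :=
  sInf {k | G.Colorable k}

/-- `σ(G)`: the minimum size of a color class among proper colorings with `χ(G)` colors. -/
noncomputable def sigmaG {V : Type*} [Fintype V] (G : SimpleGraph V) : ℕ :=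
  sInf {m | ∃ C : G.Coloring (Fin (chromNum G)), ∃ i,
    (Finset.univ.filter (fun v => C v = i)).card = m}

/-- The independence number of `G`. -/
noncomputable def indepNum {V : Type*} [Fintype V] (G : SimpleGraph V) : ℕ :=
  sSup {m | ∃ s : Finset V, s.card = m ∧ ∀ a ∈ s, ∀ b ∈ s, ¬ G.Adj a b}

/-- `f` describes a cycle of length `m` in `R`. -/
def CycleIn {V : Type*} (R : SimpleGraph V) (m : ℕ) (f : ZMod m → V) : Prop :=
  3 ≤ m ∧ Function.Injective f ∧ ∀ i, R.Adj (f i) (f (i + 1))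

/-- `f` describes a longest cycle (of length `m`) in `R`. -/
def LongestCycle {V : Type*} (R : SimpleGraph V) (m : ℕ) (f : ZMod m → V) : Prop :=
  CycleIn R m f ∧ ∀ (m' : ℕ) (g : ZMod m' → V), CycleIn R m' g → m' ≤ m

/-- The `k`-th power of the path on `n` vertices. -/
def pathPower (n k : ℕ) : SimpleGraph (Fin n) :=
  SimpleGraph.fromRel (fun i j => (i : ℕ) < j ∧ (j : ℕ) ≤ i + k)

open scoped Finset

namespace SimpleGraph

variable {V : Type*} {G : SimpleGraph V}

/-- A path whose ends are adjacent closes up to a cycle on the same vertices. -/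
theorem exists_isCycle_of_isChain {u w : V} {p : List V} (hp : p ≠ [])
    (hchain : (u :: p ++ [w]).IsChain G.Adj) (hnodup : (u :: p ++ [w]).Nodup) (h : G.Adj w u) :
    ∃ (v : V) (q : G.Walk v v), q.IsCycle ∧ q.length = (u :: p ++ [w]).length := by
  have hne : u :: p ++ [w] ≠ [] := by simp
  have hhead : (u :: p ++ [w]).head hne = u := by simp
  have hlast : (u :: p ++ [w]).getLast hne = w := by simp
  obtain ⟨r, hsupp⟩ : ∃ r : G.Walk u w, r.support = u :: p ++ [w] :=
    ⟨(Walk.ofSupport _ hne hchain).copy hhead hlast, by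
      rw [Walk.support_copy, Walk.support_ofSupport]⟩
  have hlen : r.length + 1 = p.length + 2 := by rw [← r.length_support, hsupp]; simp
  have hr : r.IsPath := by rw [Walk.isPath_def, hsupp]; exact hnodup
  refine ⟨w, Walk.cons h r, (Walk.cons_isCycle_iff r h).2 ⟨hr, fun hmem => ?_⟩, by simpa using hlen⟩
  have := hr.length_eq_one_of_mem_edges (Sym2.eq_swap ▸ hmem)
  have := List.length_pos_iff.2 hp
  omega

/-- A Pósa rotation of a path. -/
theorem isChain_rotate {v w : V} {s q : List V} (hchain : (s ++ v :: w :: q).IsChain G.Adj)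
    (hadj : ∀ u ∈ (s ++ [v]).head?, G.Adj u w) :
    (v :: s.reverse ++ w :: q).IsChain G.Adj := by
  have hsplit : s ++ v :: w :: q = (s ++ [v]) ++ w :: q := by simp
  rw [hsplit, List.isChain_append] at hchain
  have hrev : v :: s.reverse = (s ++ [v]).reverse := by simp
  rw [hrev, List.isChain_append, List.isChain_reverse]
  refine ⟨hchain.1.imp fun a b h => h.symm, hchain.2.1, ?_⟩
  rw [List.getLast?_reverse]
  intro x hx y hy
  obtain rfl : w = y := by simpa using hy
  exact hadj x hx

/-- A nodup list in `U` of maximal length among those forming a path. -/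
theorem exists_longest_path (G : SimpleGraph V) (U : Finset V) :
    ∃ l : List V, (l.IsChain G.Adj ∧ l.Nodup ∧ ∀ x ∈ l, x ∈ U) ∧
      ∀ l' : List V, l'.IsChain G.Adj → l'.Nodup → (∀ x ∈ l', x ∈ U) → l'.length ≤ l.length := by
  classical
  let P : ℕ → Prop := fun n =>
    ∃ l : List V, (l.IsChain G.Adj ∧ l.Nodup ∧ ∀ x ∈ l, x ∈ U) ∧ l.length = n
  have hbound {l : List V} (hl : l.Nodup) (hU : ∀ x ∈ l, x ∈ U) : l.length ≤ #U := by
    rw [← List.toFinset_card_of_nodup hl]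
    exact card_le_card fun x hx => hU x (List.mem_toFinset.1 hx)
  have hP : P (Nat.findGreatest P #U) :=
    Nat.findGreatest_spec (Nat.zero_le _) ⟨[], by simp, rfl⟩
  obtain ⟨l, hl, hlen⟩ := hP
  refine ⟨l, hl, fun l' h1 h2 h3 => ?_⟩
  rw [hlen]
  exact Nat.le_findGreatest (hbound h2 h3) ⟨l', ⟨h1, h2, h3⟩, rfl⟩

variable [DecidableEq V] [DecidableRel G.Adj]

/-- If all paths on at least `c` vertices have nonadjacent ends, then every nonempty set `U`
contains a nonempty set `S` of fewer than `c` vertices incident to few edges of `G[U]`. -/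
theorem exists_sparse_subset {c : ℕ} (hc : 3 ≤ c)
    (hno : ∀ (u w : V) (p : List V), (u :: p ++ [w]).IsChain G.Adj → (u :: p ++ [w]).Nodup →
      c ≤ (u :: p ++ [w]).length → ¬ G.Adj w u)
    {U : Finset V} (hU : U.Nonempty) :
    ∃ S ⊆ U, S.Nonempty ∧ #S < c ∧
      ∀ u ∈ S, #{w ∈ S | G.Adj u w} + 2 * #{w ∈ U \ S | G.Adj u w} ≤ c - 1 := by
  classical
  obtain ⟨l, ⟨hchain, hnodup, hlU⟩, hmax⟩ := exists_longest_path G U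
  have hlpos : 0 < l.length := by
    obtain ⟨v, hv⟩ := hU
    exact hmax [v] (by simp) (by simp) (by simpa using hv)
  obtain ⟨A, B, hAB, hA, hB⟩ : ∃ A B : List V, l = A ++ B ∧ A.length ≤ c - 1 ∧
      (B ≠ [] → A.length = c - 1) := by
    refine ⟨l.take (c - 1), l.drop (c - 1), by simp, by simp, fun h => ?_⟩
    have : c - 1 < l.length := by simpa using h
    simp [this.le]
  have hApos : A ≠ [] := by
    rintro rfl
    rcases eq_or_ne B [] with rfl | h
    · simp [hAB] at hlpos
    · have := hB h
      simp at this
      omega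
  subst hAB
  let S : Finset V := {u ∈ U | ∃ t, (u :: t).Perm A ∧ (u :: t ++ B).IsChain G.Adj}
  have hSA : S ⊆ A.toFinset := by
    intro u hu
    obtain ⟨-, t, ht, -⟩ := by simpa [S] using hu
    exact List.mem_toFinset.2 (ht.subset (by simp))
  have hAcard : #A.toFinset ≤ c - 1 := (List.toFinset_card_le A).trans hA
  have hScard : #S ≤ #A.toFinset := card_le_card hSA
  have hnbr {u : V} (hu : u ∈ S) : {w ∈ U | G.Adj u w} ⊆ A.toFinset := by
    intro w hw
    obtain ⟨hwU, huw⟩ := by simpa using hw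
    obtain ⟨-, t, ht, htB⟩ := by simpa [S] using hu
    have hperm : (u :: t ++ B).Perm (A ++ B) := ht.append_right B
    have hnd : (u :: t ++ B).Nodup := hperm.nodup_iff.2 hnodup
    rw [List.mem_toFinset]
    by_contra hwA
    by_cases hwB : w ∈ B
    · obtain ⟨B₁, B₂, rfl⟩ := List.append_of_mem hwB
      have hinfix : u :: (t ++ B₁) ++ [w] <+: u :: t ++ (B₁ ++ w :: B₂) := ⟨B₂, by simp⟩
      refine hno u w (t ++ B₁) (htB.infix hinfix.isInfix) (hnd.sublist hinfix.sublist) ?_ huw.symm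
      have := hB (by simp)
      have := ht.length_eq
      simp at this ⊢
      omega
    · have := hmax (w :: (u :: t ++ B)) (by simpa using ⟨huw.symm, by simpa using htB⟩)
        (List.nodup_cons.2 ⟨fun h => by simpa [hwA, hwB] using hperm.subset h, hnd⟩)
        (by
          intro x hx
          rcases List.mem_cons.1 hx with rfl | hx
          · exact hwU
          · exact hlU x (hperm.subset hx))
      have := hperm.length_eq
      simp at *
      omega
  have hdeg {u : V} (hu : u ∈ S) : #{w ∈ U | G.Adj u w} ≤ #S := by
    have hN := hnbr hu
    obtain ⟨-, t, ht, htB⟩ := by simpa [S] using hu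
    have hnd : (u :: t).Nodup := ht.nodup_iff.2 hnodup.of_append_left
    suffices {w ∈ U | G.Adj u w} ⊆ S.image fun v => (u :: t).getD ((u :: t).idxOf v + 1) u from
      (card_le_card this).trans card_image_le
    intro w hw
    have huw : G.Adj u w := (mem_filter.1 hw).2
    have hwt : w ∈ t := by
      have : w ∈ u :: t := ht.symm.subset (List.mem_toFinset.1 (hN hw))
      exact (List.mem_cons.1 this).resolve_left huw.ne'
    obtain ⟨p, q, rfl⟩ := List.append_of_mem hwt
    obtain ⟨s, v, hsv⟩ : ∃ s v, u :: p = s ++ [v] :=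
      ⟨_, _, (List.dropLast_append_getLast (List.cons_ne_nil u p)).symm⟩
    have hl : u :: (p ++ w :: q) = s ++ v :: w :: q := by
      rw [← List.cons_append, hsv]; simp
    rw [hl] at hnd ht ⊢
    have hchain' : (v :: (s.reverse ++ w :: q) ++ B).IsChain G.Adj := by
      have := isChain_rotate (G := G) (s := s) (v := v) (w := w) (q := q ++ B)
        (by rw [← List.cons_append, hl] at htB; simpa only [List.append_assoc, List.cons_append] using htB)
        (by simpa [← hsv] using huw)
      simpa using this
    have hperm' : (v :: (s.reverse ++ w :: q)).Perm A := by
      refine List.Perm.trans ?_ ht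
      have h1 : (v :: (s.reverse ++ w :: q)) = (s ++ [v]).reverse ++ w :: q := by simp
      have h2 : s ++ v :: w :: q = (s ++ [v]) ++ w :: q := by simp
      rw [h1, h2]
      exact (List.reverse_perm _).append_right _
    have hvs : v ∉ s := by grind
    refine mem_image.2 ⟨v, mem_filter.2 ⟨?_, _, hperm', hchain'⟩, ?_⟩
    · exact hlU v (List.mem_append_left _ (hperm'.subset (by simp)))
    · simp [List.idxOf_append_of_notMem hvs]
  refine ⟨S, filter_subset _ _, ?_, by omega, fun u hu => ?_⟩
  · obtain ⟨a, t, rfl⟩ := List.exists_cons_of_ne_nil hApos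
    exact ⟨a, mem_filter.2 ⟨hlU a (by simp), t, List.Perm.refl _, hchain⟩⟩
  · have h1 : #{w ∈ S | G.Adj u w} + #{w ∈ U \ S | G.Adj u w} = #{w ∈ U | G.Adj u w} := by
      rw [← card_union_of_disjoint (disjoint_filter_filter disjoint_sdiff), ← filter_union,
        union_sdiff_of_subset (filter_subset _ _)]
    have h2 : #{w ∈ U \ S | G.Adj u w} ≤ #(A.toFinset \ S) := by
      refine card_le_card fun w hw => ?_
      obtain ⟨⟨hwU, hwS⟩, huw⟩ := by simpa only [mem_filter, mem_sdiff] using hw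
      exact mem_sdiff.2 ⟨hnbr hu (mem_filter.2 ⟨hwU, huw⟩), hwS⟩
    have h3 := card_sdiff_add_card_eq_card hSA
    have h4 := hdeg hu
    omega

/-- Splitting the degree sum of `G[U]` along a subset `S ⊆ U`. -/
theorem sum_card_filter_adj_eq_add {S U : Finset V} (hSU : S ⊆ U) :
    ∑ u ∈ U, #{w ∈ U | G.Adj u w} = ∑ u ∈ U \ S, #{w ∈ U \ S | G.Adj u w} +
      ∑ u ∈ S, (#{w ∈ S | G.Adj u w} + 2 * #{w ∈ U \ S | G.Adj u w}) := by
  have hsplit (u : V) :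
      #{w ∈ U | G.Adj u w} = #{w ∈ U \ S | G.Adj u w} + #{w ∈ S | G.Adj u w} := by
    rw [← card_union_of_disjoint (disjoint_filter_filter sdiff_disjoint), ← filter_union,
      sdiff_union_of_subset hSU]
  have hcross : ∑ u ∈ U \ S, #{w ∈ S | G.Adj u w} = ∑ u ∈ S, #{w ∈ U \ S | G.Adj u w} := by
    simp_rw [card_filter]
    rw [sum_comm]
    simp_rw [G.adj_comm]
  rw [← sum_sdiff hSU]
  simp_rw [hsplit, sum_add_distrib, ← mul_sum, hcross]
  ring

/-- The degree sum form of the Erdős–Gallai bound, for induced subgraphs. -/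
theorem sum_card_filter_adj_le {c : ℕ} (hc : 3 ≤ c)
    (hno : ∀ (u w : V) (p : List V), (u :: p ++ [w]).IsChain G.Adj → (u :: p ++ [w]).Nodup →
      c ≤ (u :: p ++ [w]).length → ¬ G.Adj w u) (U : Finset V) :
    ∑ u ∈ U, #{w ∈ U | G.Adj u w} ≤ (c - 1) * (#U - 1) := by
  induction U using Finset.strongInduction with
  | H U ih =>
    rcases lt_or_ge #U c with hlt | hge
    · calc ∑ u ∈ U, #{w ∈ U | G.Adj u w} ≤ ∑ u ∈ U, (#U - 1) := by
            refine sum_le_sum fun u hu => ?_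
            rw [← card_erase_of_mem hu]
            refine card_le_card fun w hw => ?_
            obtain ⟨hwU, huw⟩ := mem_filter.1 hw
            exact mem_erase.2 ⟨huw.ne', hwU⟩
        _ = #U * (#U - 1) := by simp
        _ ≤ (c - 1) * (#U - 1) := Nat.mul_le_mul_right _ (by omega)
    · obtain ⟨S, hSU, hS, hSc, hdeg⟩ :=
        exists_sparse_subset hc hno (card_pos.1 (show 0 < #U by omega))
      rw [sum_card_filter_adj_eq_add hSU]
      have hsum := sum_le_card_nsmul S _ _ hdeg
      have hih := ih _ (sdiff_ssubset hSU hS)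
      have hcard := card_sdiff_add_card_eq_card hSU
      calc _ ≤ (c - 1) * (#(U \ S) - 1) + #S • (c - 1) := add_le_add hih hsum
        _ = (c - 1) * ((#(U \ S) - 1) + #S) := by rw [smul_eq_mul]; ring
        _ = (c - 1) * (#U - 1) := by congr 1; omega

end SimpleGraph

theorem erdos_gallai_cycles {V : Type*} [Fintype V] [DecidableEq V]
    (H : SimpleGraph V) [DecidableRel H.Adj] (c : ℕ)
    (h3 : 3 ≤ c) (hc : c ≤ Fintype.card V) :
    (∃ (v : V) (w : H.Walk v v), w.IsCycle ∧ c ≤ w.length) ∨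
    (H.edgeFinset.card : ℝ) < ((c : ℝ) - 1) * ((Fintype.card V : ℝ) - 1) / 2 + 1 := by
  refine or_iff_not_imp_left.2 fun hcycle => ?_
  have hsum := sum_card_filter_adj_le (G := H) h3 (fun u w p hchain hnodup hlen hadj => by
    have hp : p ≠ [] := by
      rintro rfl
      simp at hlen
      omega
    obtain ⟨v, q, hq, hqlen⟩ := exists_isCycle_of_isChain hp hchain hnodup hadj
    exact hcycle ⟨v, q, hq, hqlen ▸ hlen⟩) univ
  have hedges : 2 * #H.edgeFinset ≤ (c - 1) * (Fintype.card V - 1) := by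
    rw [← H.sum_degrees_eq_twice_card_edges]
    simpa [← H.card_neighborFinset_eq_degree, H.neighborFinset_eq_filter] using hsum
  have hreal : (2 * #H.edgeFinset : ℝ) ≤ ((c : ℝ) - 1) * ((Fintype.card V : ℝ) - 1) := by
    rw [← Nat.cast_pred (by omega : 0 < c), ← Nat.cast_pred (by omega : 0 < Fintype.card V)]
    exact_mod_cast hedges
  linarith
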